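/- Let p be an odd prime, f ≥ 1, q = p^f, and d = q + 1. Let F be a field of characteristic p and let K = F(u) be the rational function field. Consider the elliptic curve E over K defined by y² + xy + u^d y = x³ + u^d x² (the curve y² + xy + ty = x³ + tx² with t = u^d). Then the pair x₀ = u^q(u^q − u)/(1 + 4u)^q, y₀ = u^{2q}(1 + 2u + 2u^q)/(2(1 + 4u)^{(3q−1)/2}) − u^{2q}/(2(1 + 4u)^{q−1}) satisfies the Weierstrass equation y₀² + x₀y₀ + u^d y₀ = x₀³ + u^d x₀²; that is, P(u) = (x₀, y₀) is a K-rational point of E. -/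

import Mathlib

/-- The `x`-coordinate of Ulmer's explicit point `P(v)` on `y² + xy + ty = x³ + tx²`,
namely `v^q (v^q − v) / (1 + 4v)^q`. -/
def ulmerX {K : Type*} [Field K] (q : ℕ) (v : K) : K :=
  v ^ q * (v ^ q - v) / (1 + 4 * v) ^ q

/-- The `y`-coordinate of Ulmer's explicit point `P(v)`, namely
`v^{2q}(1 + 2v + 2v^q) / (2(1 + 4v)^{(3q−1)/2}) − v^{2q} / (2(1 + 4v)^{q−1})`. -/
def ulmerY {K : Type*} [Field K] (q : ℕ) (v : K) : K :=
  v ^ (2 * q) * (1 + 2 * v + 2 * v ^ q) / (2 * (1 + 4 * v) ^ ((3 * q - 1) / 2))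
    - v ^ (2 * q) / (2 * (1 + 4 * v) ^ (q - 1))

theorem ulmer_aux {K : Type*} [Field K] (u U w s : K) (h2 : (2 : K) ≠ 0) (hs : s ≠ 0)
    (hw : w ≠ 0) (h1 : s = 1 + 4 * u) (h3 : w ^ 2 * s = 1 + 4 * U) (x y : K)
    (hx : x = U * (U - u) / (w ^ 2 * s))
    (hy : y = U ^ 2 * (1 + 2 * u + 2 * U) / (2 * (w ^ 3 * s)) - U ^ 2 / (2 * w ^ 2)) :
    y ^ 2 + x * y + U * u * y = x ^ 3 + U * u * x ^ 2 := by
  have ht : U * u = U ^ 2 / w ^ 2 - x := by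
    rw [hx]
    field_simp
    linear_combination U * u * h3 - U ^ 2 * h1
  have hA : (U ^ 2 * (1 + 2 * u + 2 * U) / (2 * (w ^ 3 * s))) ^ 2
      = U ^ 2 / w ^ 2 * (x ^ 2 + U ^ 2 / (4 * w ^ 2)) := by
    have h4 : (4 : K) ≠ 0 := by
      have : (4 : K) = 2 * 2 := by norm_num
      rw [this]; exact mul_ne_zero h2 h2
    have e : (1 + 2 * u + 2 * U) ^ 2 = 4 * (U - u) ^ 2 + w ^ 2 * s ^ 2 := by
      linear_combination -s * h3 - (1 + 4 * U) * h1
    rw [div_pow, mul_pow, e, hx]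
    field_simp
    ring
  have hy2 : y = U ^ 2 * (1 + 2 * u + 2 * U) / (2 * (w ^ 3 * s)) - (U ^ 2 / w ^ 2) / 2 := by
    rw [hy]; field_simp
  rw [ht]
  have h5 : U ^ 2 / (4 * w ^ 2) = (U ^ 2 / w ^ 2) / 2 ^ 2 := by
    rw [div_div]; congr 1; ring
  rw [h5] at hA
  generalize U ^ 2 * (1 + 2 * u + 2 * U) / (2 * (w ^ 3 * s)) = A at *
  generalize U ^ 2 / w ^ 2 = B at *
  subst hy2
  field_simp at hA ⊢
  linear_combination hA

/-- Let `p` be an odd prime, `q = p^f`, `d = q + 1`, `F` a field of characteristic `p`, and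
`K = F(u)`.  Then the pair `(x₀, y₀) = P(u)` given by the explicit formulas above satisfies
the Weierstrass equation `y² + xy + u^d y = x³ + u^d x²`, i.e. it is a `K`-rational point of
the elliptic curve `y² + xy + ty = x³ + tx²` over `K` with `t = u^d`. -/
theorem ulmer_point_satisfies_weierstrass_equation
    (p f q d : ℕ) (hp : p.Prime) (hodd : Odd p) (hf : 1 ≤ f)
    (hq : q = p ^ f) (hd : d = q + 1)
    (F : Type*) [Field F] [CharP F p] :
    letI u : RatFunc F := RatFunc.X
    letI x₀ : RatFunc F := ulmerX q u
    letI y₀ : RatFunc F := ulmerY q u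
    y₀ ^ 2 + x₀ * y₀ + u ^ d * y₀ = x₀ ^ 3 + u ^ d * x₀ ^ 2 := by
  set u : RatFunc F := RatFunc.X with hu
  set x₀ : RatFunc F := ulmerX q u with hx₀
  set y₀ : RatFunc F := ulmerY q u with hy₀
  have : Fact p.Prime := ⟨hp⟩
  have : CharP (RatFunc F) p := charP_of_injective_algebraMap (algebraMap F (RatFunc F)).injective p
  have hqo : Odd q := hq ▸ hodd.pow
  obtain ⟨m, hm⟩ := hqo
  have h2 : (2 : RatFunc F) ≠ 0 := by
    intro h
    have h' : ((2 : ℕ) : RatFunc F) = 0 := by exact_mod_cast h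
    rw [CharP.cast_eq_zero_iff (RatFunc F) p] at h'
    have := (Nat.prime_dvd_prime_iff_eq hp Nat.prime_two).1 h'
    subst this
    exact absurd hodd (by decide)
  have hs : 1 + 4 * u ≠ 0 := by
    intro h
    have h' : algebraMap (Polynomial F) (RatFunc F) (1 + 4 * Polynomial.X) = 0 := by
      rw [map_add, map_mul, map_one, map_ofNat, RatFunc.algebraMap_X]
      exact h
    rw [map_eq_zero_iff _ (RatFunc.algebraMap_injective F)] at h'
    have := congrArg (Polynomial.eval 0) h'
    simp at this
  have hfrob : (1 + 4 * u) ^ q = 1 + 4 * u ^ q := by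
    have h4 : (4 : RatFunc F) ^ p ^ f = 4 := by
      have := map_natCast (iterateFrobenius (RatFunc F) p f) 4
      simpa [iterateFrobenius_def] using this
    rw [hq, add_pow_char_pow, mul_pow, one_pow, h4]
  have hS : ((1 + 4 * u) ^ m) ^ 2 * (1 + 4 * u) = (1 + 4 * u) ^ q := by
    rw [hm]; ring
  have key := ulmer_aux u (u ^ q) ((1 + 4 * u) ^ m) (1 + 4 * u) h2 hs (pow_ne_zero _ hs) rfl
    (hS.trans hfrob) x₀ y₀ (by rw [hS]; rfl) (by
      have e1 : (3 * q - 1) / 2 = 3 * m + 1 := by omega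
      have e2 : q - 1 = 2 * m := by omega
      simp only [y₀, ulmerY, e1, e2]
      rw [← pow_mul, ← pow_mul, ← pow_mul, ← pow_succ, mul_comm q 2, mul_comm m 3, mul_comm m 2])
  rw [hd, pow_succ]
  exact key
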